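/- Let E be a real normed vector space, let K ⊆ E be a convex set, and let J : E → ℝ be twice continuously differentiable. Suppose u ∈ K is a local minimum of J on K (there exists ε > 0 such that J(u) ≤ J(v) for every v ∈ K with ‖v − u‖ ≤ ε), and let w ∈ K satisfy J′(u)(w − u) = 0. Then J″(u)[w − u, w − u] ≥ 0. -/

import Mathlib

open Filter Topology in
/-- One-sided second-order necessary condition: if `g 0 ≤ g t` for small `t > 0` and `g' 0 = 0`,
then the derivative of `g'` at `0` is nonnegative. -/
lemma HasDerivAt.nonneg_of_eventually_le_right {g g' : ℝ → ℝ} {c : ℝ}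
    (hg : ∀ t, HasDerivAt g (g' t) t) (hg' : HasDerivAt g' c 0) (h0 : g' 0 = 0)
    (hmin : ∀ᶠ t in 𝓝[>] (0 : ℝ), g 0 ≤ g t) : 0 ≤ c := by
  by_contra! hc
  have hneg : ∀ᶠ t in 𝓝[>] (0 : ℝ), g' t < 0 := by
    filter_upwards [hg'.tendsto_slope_zero_right.eventually_lt_const hc, self_mem_nhdsWithin]
      with t ht (htpos : 0 < t)
    simp only [zero_add, h0, sub_zero, smul_eq_mul] at ht
    exact neg_of_mul_neg_right ht (inv_nonneg.2 htpos.le)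
  obtain ⟨δ, hδ, hδ'⟩ := mem_nhdsGT_iff_exists_Ioo_subset.1 (hneg.and hmin)
  have hδ : 0 < δ := hδ
  have hanti : StrictAntiOn g (Set.Icc 0 (δ / 2)) := by
    refine strictAntiOn_of_deriv_neg (convex_Icc _ _)
      (fun t _ => (hg t).continuousAt.continuousWithinAt) fun t ht => ?_
    rw [interior_Icc] at ht
    rw [(hg t).deriv]
    exact (hδ' ⟨ht.1, by linarith [ht.2]⟩).1
  have hlt := hanti (Set.left_mem_Icc.2 (by linarith)) (Set.right_mem_Icc.2 (by linarith))
    (half_pos hδ)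
  exact hlt.not_ge (hδ' ⟨half_pos hδ, half_lt_self hδ⟩).2

/-- Second-order necessary optimality condition: if `J` is twice continuously
differentiable, `u` is a local minimum of `J` on the convex set `K`, and `w ∈ K` is a
critical direction (`J'(u)(w - u) = 0`), then `J''(u)[w - u, w - u] ≥ 0`. -/
theorem stmt8 {E : Type*} [NormedAddCommGroup E] [NormedSpace ℝ E]
    (K : Set E) (hK : Convex ℝ K) (J : E → ℝ) (hJ : ContDiff ℝ 2 J) (u : E) (huK : u ∈ K)
    (hmin : ∃ ε > 0, ∀ v ∈ K, ‖v - u‖ ≤ ε → J u ≤ J v)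
    (w : E) (hwK : w ∈ K) (hcrit : fderiv ℝ J u (w - u) = 0) :
    0 ≤ fderiv ℝ (fderiv ℝ J) u (w - u) (w - u) := by
  obtain ⟨ε, hε, hmin⟩ := hmin
  have hline (t : ℝ) : HasDerivAt (fun t : ℝ => u + t • (w - u)) (w - u) t := by
    simpa using ((hasDerivAt_id t).smul_const (w - u)).const_add u
  have hJ' : Differentiable ℝ J := hJ.differentiable (by norm_num)
  have hJ'' : Differentiable ℝ (fderiv ℝ J) :=
    (hJ.fderiv_right (m := 1) (by norm_num)).differentiable (by norm_num)
  have hsecond : HasDerivAt (fun t : ℝ => fderiv ℝ J (u + t • (w - u)) (w - u))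
      (fderiv ℝ (fderiv ℝ J) u (w - u) (w - u)) 0 := by
    have hcomp : HasDerivAt (fun t : ℝ => fderiv ℝ J (u + t • (w - u)))
        (fderiv ℝ (fderiv ℝ J) u (w - u)) 0 :=
      (hJ'' u).hasFDerivAt.comp_hasDerivAt_of_eq 0 (hline 0) (by simp)
    exact (ContinuousLinearMap.apply ℝ ℝ (w - u)).hasFDerivAt.comp_hasDerivAt 0 hcomp
  refine HasDerivAt.nonneg_of_eventually_le_right (g := fun t : ℝ => J (u + t • (w - u)))
    (fun t => (hJ' _).hasFDerivAt.comp_hasDerivAt t (hline t)) hsecond (by simpa using hcrit) ?_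
  have hsmall : ∀ᶠ t in nhds (0 : ℝ), ‖t • (w - u)‖ < ε :=
    (show Continuous fun t : ℝ => ‖t • (w - u)‖ by fun_prop).continuousAt.eventually_lt
      continuousAt_const (by simpa using hε)
  filter_upwards [nhdsWithin_le_nhds hsmall, Ioo_mem_nhdsGT (zero_lt_one' ℝ)] with t ht ht'
  simpa using hmin (u + t • (w - u))
    (hK.add_smul_sub_mem huK hwK ⟨ht'.1.le, ht'.2.le⟩) (by simpa using ht.le)
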